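/- Let q ≥ 1 be an integer and let (s_j)_{j=0}^∞ be a Stieltjes positive definite sequence of complex q×q matrices. Then for all k, ℓ ∈ ℕ₀ and all z ∈ ℂ: 𝕃_k^{(ℓ)} · 𝐐_0^{(ℓ)}(z) = 𝐐_0^{(ℓ)}(z) · 𝕄_k^{(ℓ+1)}(z) and 𝕄_{k+1}^{(ℓ)}(z) · 𝐐_0^{(ℓ)}(z) = 𝐐_0^{(ℓ)}(z) · 𝕃_k^{(ℓ+1)}. -/

import Mathlib

open Matrix
open scoped ComplexOrder

noncomputable section

/-- The space of complex `q × q` matrices. -/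
abbrev Mq (q : ℕ) := Matrix (Fin q) (Fin q) ℂ

/-- The space of complex `2q × 2q` matrices, written in `q × q` blocks. -/
abbrev M2q (q : ℕ) := Matrix (Fin q ⊕ Fin q) (Fin q ⊕ Fin q) ℂ

/-- Block Hankel matrix `H_n = (s_{j+k})_{j,k=0}^n`. -/
def Hmat (q : ℕ) (s : ℕ → Mq q) (n : ℕ) :
    Matrix (Fin (n + 1) × Fin q) (Fin (n + 1) × Fin q) ℂ :=
  Matrix.of fun p r => s (p.1.1 + r.1.1) p.2 r.2

/-- Block Hankel matrix `K_n = (s_{j+k+1})_{j,k=0}^n`. -/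
def Kmat (q : ℕ) (s : ℕ → Mq q) (n : ℕ) :
    Matrix (Fin (n + 1) × Fin q) (Fin (n + 1) × Fin q) ℂ :=
  Matrix.of fun p r => s (p.1.1 + r.1.1 + 1) p.2 r.2

/-- A sequence of complex `q × q` matrices is Stieltjes positive definite if all the
block Hankel matrices `H_n` and `K_n` are positive definite (in particular Hermitian). -/
def IsStieltjesPD (q : ℕ) (s : ℕ → Mq q) : Prop :=
  ∀ n : ℕ, (Hmat q s n).PosDef ∧ (Kmat q s n).PosDef

/-- Even Stieltjes parameters `𝔮_{2k}` (Schur complements `L_k`). -/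
def qEven (q : ℕ) (s : ℕ → Mq q) : ℕ → Mq q
  | 0 => s 0
  | k + 1 =>
      s (2 * (k + 1)) -
        (Matrix.of fun (a : Fin q) (r : Fin (k + 1) × Fin q) => s (k + 1 + r.1.1) a r.2) *
          (Hmat q s k)⁻¹ *
          (Matrix.of fun (p : Fin (k + 1) × Fin q) (b : Fin q) => s (k + 1 + p.1.1) p.2 b)

/-- Odd Stieltjes parameters `𝔮_{2k+1}` (Schur complements `Λ_k`). -/
def qOdd (q : ℕ) (s : ℕ → Mq q) : ℕ → Mq q
  | 0 => s 1
  | k + 1 =>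
      s (2 * (k + 1) + 1) -
        (Matrix.of fun (a : Fin q) (r : Fin (k + 1) × Fin q) => s (k + 2 + r.1.1) a r.2) *
          (Kmat q s k)⁻¹ *
          (Matrix.of fun (p : Fin (k + 1) × Fin q) (b : Fin q) => s (k + 2 + p.1.1) p.2 b)

/-- Stieltjes parametrization `𝔮_j`. -/
def qpar (q : ℕ) (s : ℕ → Mq q) (j : ℕ) : Mq q :=
  if j % 2 = 0 then qEven q s (j / 2) else qOdd q s (j / 2)

/-- Reciprocal sequence `s^♯`. -/
def reciprocal (q : ℕ) (s : ℕ → Mq q) : ℕ → Mq q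
  | 0 => (s 0)⁻¹
  | j + 1 =>
      -(s 0)⁻¹ *
        ∑ l ∈ (Finset.range (j + 1)).attach, s (j + 1 - l.1) * reciprocal q s l.1
  decreasing_by exact Finset.mem_range.mp l.2

/-- First Kátětov transform `s^{(1)}_j = −s_0 s_{j+1}^♯ s_0`. -/
def katetov1 (q : ℕ) (s : ℕ → Mq q) : ℕ → Mq q :=
  fun j => -(s 0) * reciprocal q s (j + 1) * s 0

/-- `ℓ`-th Kátětov transform (the `ℓ`-fold iterate of the first Kátětov transform). -/
def katetov (q : ℕ) (ℓ : ℕ) (s : ℕ → Mq q) : ℕ → Mq q :=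
  (katetov1 q)^[ℓ] s

/-- `v_k = col(I_q, 0_{kq×q})`. -/
def vcol (q k : ℕ) : Matrix (Fin (k + 1) × Fin q) (Fin q) ℂ :=
  Matrix.of fun p b => if p.1.1 = 0 ∧ p.2 = b then 1 else 0

/-- `y_{0,k} = col(s_0, …, s_k)`. -/
def ycol (q : ℕ) (s : ℕ → Mq q) (k : ℕ) : Matrix (Fin (k + 1) × Fin q) (Fin q) ℂ :=
  Matrix.of fun p b => s p.1.1 p.2 b

/-- Dyukarev–Stieltjes parameters `𝔐_k`. -/
def DSM (q : ℕ) (s : ℕ → Mq q) : ℕ → Mq q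
  | 0 => (s 0)⁻¹
  | k + 1 =>
      (vcol q (k + 1))ᴴ * (Hmat q s (k + 1))⁻¹ * vcol q (k + 1) -
        (vcol q k)ᴴ * (Hmat q s k)⁻¹ * vcol q k

/-- Dyukarev–Stieltjes parameters `𝔏_k`. -/
def DSL (q : ℕ) (s : ℕ → Mq q) : ℕ → Mq q
  | 0 => s 0 * (s 1)⁻¹ * s 0
  | k + 1 =>
      (ycol q s (k + 1))ᴴ * (Kmat q s (k + 1))⁻¹ * ycol q s (k + 1) -
        (ycol q s k)ᴴ * (Kmat q s k)⁻¹ * ycol q s k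

/-- Ordered product `A_0 A_1 ⋯ A_n`. -/
def oprod {α : Type*} [Monoid α] (f : ℕ → α) (n : ℕ) : α :=
  ((List.range (n + 1)).map f).prod

/-- Block shift `T_n = (δ_{j,k+1} I_q)_{j,k=0}^n`. -/
def Tmat (q n : ℕ) : Matrix (Fin (n + 1) × Fin q) (Fin (n + 1) × Fin q) ℂ :=
  Matrix.of fun p r => if p.1.1 = r.1.1 + 1 ∧ p.2 = r.2 then 1 else 0

/-- `R_n(z) = (I_{(n+1)q} − z T_n)⁻¹`. -/
def Rmat (q n : ℕ) (z : ℂ) : Matrix (Fin (n + 1) × Fin q) (Fin (n + 1) × Fin q) ℂ :=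
  (1 - z • Tmat q n)⁻¹

/-- `u_0 = 0`, `u_n = col(0_{q×q}, −y_{0,n−1})`. -/
def ucol (q : ℕ) (s : ℕ → Mq q) (n : ℕ) : Matrix (Fin (n + 1) × Fin q) (Fin q) ℂ :=
  Matrix.of fun p b => if p.1.1 = 0 then 0 else -(s (p.1.1 - 1) p.2 b)

/-- `col(−H_n⁻¹ y_{n+1,2n+1}, I_q)` of size `(n+2)q × q`. -/
def colH (q : ℕ) (s : ℕ → Mq q) (n : ℕ) : Matrix (Fin (n + 2) × Fin q) (Fin q) ℂ :=
  Matrix.of fun p b =>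
    if h : p.1.1 < n + 1 then
      (-((Hmat q s n)⁻¹ *
          Matrix.of fun (r : Fin (n + 1) × Fin q) (c : Fin q) => s (n + 1 + r.1.1) r.2 c))
        (⟨p.1.1, h⟩, p.2) b
    else if p.2 = b then 1 else 0

/-- `col(−K_n⁻¹ y_{n+2,2n+2}, I_q)` of size `(n+2)q × q`. -/
def colK (q : ℕ) (s : ℕ → Mq q) (n : ℕ) : Matrix (Fin (n + 2) × Fin q) (Fin q) ℂ :=
  Matrix.of fun p b =>
    if h : p.1.1 < n + 1 then
      (-((Kmat q s n)⁻¹ *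
          Matrix.of fun (r : Fin (n + 1) × Fin q) (c : Fin q) => s (n + 2 + r.1.1) r.2 c))
        (⟨p.1.1, h⟩, p.2) b
    else if p.2 = b then 1 else 0

/-- `z_{0,n} = row(s_0, …, s_n)`. -/
def zrow (q : ℕ) (s : ℕ → Mq q) (n : ℕ) : Matrix (Fin q) (Fin (n + 1) × Fin q) ℂ :=
  Matrix.of fun a r => s r.1.1 a r.2

/-- Orthogonal matrix polynomials `P_n`. -/
def Ppoly (q : ℕ) (s : ℕ → Mq q) : ℕ → ℂ → Mq q
  | 0, _ => 1
  | n + 1, z => (vcol q (n + 1))ᴴ * (Rmat q (n + 1) (starRingEnd ℂ z))ᴴ * colH q s n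

/-- Second kind matrix polynomials `Q_n`. -/
def Qpoly (q : ℕ) (s : ℕ → Mq q) : ℕ → ℂ → Mq q
  | 0, _ => 0
  | n + 1, z => -((ucol q s (n + 1))ᴴ * (Rmat q (n + 1) (starRingEnd ℂ z))ᴴ * colH q s n)

/-- Matrix polynomials `P̂_n`. -/
def Phat (q : ℕ) (s : ℕ → Mq q) : ℕ → ℂ → Mq q
  | 0, _ => 1
  | n + 1, z => (vcol q (n + 1))ᴴ * (Rmat q (n + 1) (starRingEnd ℂ z))ᴴ * colK q s n

/-- Matrix polynomials `Q̂_n`. -/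
def Qhat (q : ℕ) (s : ℕ → Mq q) : ℕ → ℂ → Mq q
  | 0, _ => s 0
  | n + 1, z => zrow q s (n + 1) * (Rmat q (n + 1) (starRingEnd ℂ z))ᴴ * colK q s n

/-- `α_n(z)`. -/
def alphaP (q : ℕ) (s : ℕ → Mq q) (n : ℕ) (z : ℂ) : Mq q :=
  1 - z • ((ucol q s n)ᴴ * (Rmat q n (starRingEnd ℂ z))ᴴ * (Hmat q s n)⁻¹ * vcol q n)

/-- `γ_n(z)`. -/
def gammaP (q : ℕ) (s : ℕ → Mq q) (n : ℕ) (z : ℂ) : Mq q :=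
  -(z • ((vcol q n)ᴴ * (Rmat q n (starRingEnd ℂ z))ᴴ * (Hmat q s n)⁻¹ * vcol q n))

/-- `β_n(z)`. -/
def betaP (q : ℕ) (s : ℕ → Mq q) : ℕ → ℂ → Mq q
  | 0, _ => 0
  | n + 1, z => (ycol q s n)ᴴ * (Rmat q n (starRingEnd ℂ z))ᴴ * (Kmat q s n)⁻¹ * ycol q s n

/-- `δ_n(z)`. -/
def deltaP (q : ℕ) (s : ℕ → Mq q) : ℕ → ℂ → Mq q
  | 0, _ => 1
  | n + 1, z =>
      1 + z • ((vcol q n)ᴴ * (Rmat q n (starRingEnd ℂ z))ᴴ * (Kmat q s n)⁻¹ * ycol q s n)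

/-- The resolvent matrices `U_m(z)`. -/
def Umat (q : ℕ) (s : ℕ → Mq q) (m : ℕ) (z : ℂ) : M2q q :=
  if m % 2 = 0 then
    Matrix.fromBlocks (alphaP q s (m / 2) z) (betaP q s (m / 2) z)
      (gammaP q s (m / 2) z) (deltaP q s (m / 2) z)
  else
    Matrix.fromBlocks (alphaP q s (m / 2) z) (betaP q s (m / 2 + 1) z)
      (gammaP q s (m / 2) z) (deltaP q s (m / 2 + 1) z)

/-- `𝕄_k(z) = [[I, 0], [−z𝔐_k, I]]`. -/
def MM (q : ℕ) (s : ℕ → Mq q) (k : ℕ) (z : ℂ) : M2q q :=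
  Matrix.fromBlocks 1 0 (-(z • DSM q s k)) 1

/-- `𝕃_k = [[I, 𝔏_k], [0, I]]`. -/
def LL (q : ℕ) (s : ℕ → Mq q) (k : ℕ) : M2q q :=
  Matrix.fromBlocks 1 (DSL q s k) 0 1

/-- `𝒫_n = diag([P_n(0)]^{−*}, P_n(0))`. -/
def PPmat (q : ℕ) (s : ℕ → Mq q) (n : ℕ) : M2q q :=
  Matrix.fromBlocks (((Ppoly q s n 0)⁻¹)ᴴ) 0 0 (Ppoly q s n 0)

/-- `𝐐_n(z) = [[0, Q̂_n(0)], [−z[Q̂_n(0)]^{−*}, 0]]`. -/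
def QQgen (q : ℕ) (s : ℕ → Mq q) (n : ℕ) (z : ℂ) : M2q q :=
  Matrix.fromBlocks 0 (Qhat q s n 0) (-(z • ((Qhat q s n 0)⁻¹)ᴴ)) 0

/-- `𝐐_0^{(ℓ)}(z) = [[0, s_0^{(ℓ)}], [−z(s_0^{(ℓ)})⁻¹, 0]]`. -/
def QQ0 (q : ℕ) (s : ℕ → Mq q) (ℓ : ℕ) (z : ℂ) : M2q q :=
  Matrix.fromBlocks 0 (katetov q ℓ s 0) (-(z • (katetov q ℓ s 0)⁻¹)) 0

/-- `𝒬_m(z) = 𝐐_0^{(0)}(z) ⋯ 𝐐_0^{(m)}(z)`. -/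
def Qprod (q : ℕ) (s : ℕ → Mq q) (m : ℕ) (z : ℂ) : M2q q :=
  oprod (fun ℓ => QQ0 q s ℓ z) m

/-! ### Convolution identities in a ring -/

lemma left_conv {R : Type*} [Ring R] (s r : ℕ → R) (b : R) (hb : b * s 0 = 1)
    (h : ∀ n, ∑ i ∈ Finset.range (n + 1), s (n - i) * r i = if n = 0 then 1 else 0) (n : ℕ) :
    ∑ i ∈ Finset.range (n + 1), r i * s (n - i) = if n = 0 then 1 else 0 := by
  have key : ∀ f g : ℕ → R, ∀ n, PowerSeries.coeff n (PowerSeries.mk f * PowerSeries.mk g) =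
      ∑ i ∈ Finset.range (n + 1), f i * g (n - i) := by
    intro f g n
    rw [PowerSeries.coeff_mul, Finset.Nat.sum_antidiagonal_eq_sum_range_succ_mk]
    simp
  have h1 : PowerSeries.mk s * PowerSeries.mk r = 1 := by
    ext n
    rw [key, ← Finset.sum_range_reflect, PowerSeries.coeff_one, ← h n]
    refine Finset.sum_congr rfl fun i hi => ?_
    have := Finset.mem_range.mp hi
    congr 2 <;> omega
  have h2 : PowerSeries.mk s * (PowerSeries.mk r * PowerSeries.mk s - 1) = 0 := by
    rw [mul_sub, ← mul_assoc, h1]; simp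
  have h3 : PowerSeries.mk r * PowerSeries.mk s - 1 = 0 := by
    generalize PowerSeries.mk r * PowerSeries.mk s - 1 = T at h2
    ext n
    induction n using Nat.strong_induction_on with
    | _ n ih =>
      have h4 := congrArg (PowerSeries.coeff n) h2
      rw [PowerSeries.coeff_mul, Finset.sum_eq_single (0, n)] at h4
      · have h5 := congrArg (b * ·) h4
        simpa [← mul_assoc, hb] using h5
      · rintro ⟨i, j⟩ hij hne
        rw [Finset.HasAntidiagonal.mem_antidiagonal] at hij
        simp only at hij
        have : j < n := by
          rcases Nat.eq_zero_or_pos i with h0 | h0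
          · subst h0; exfalso; apply hne; simp at hij; simp [hij]
          · omega
        simp [ih j this]
      · simp
  rw [← key, sub_eq_zero.mp h3, PowerSeries.coeff_one]

lemma conv_shift {R : Type*} [Ring R] (s r : ℕ → R) (b : R) (hr : r 0 = b)
    (h : ∀ n, ∑ i ∈ Finset.range (n + 1), s (n - i) * r i = if n = 0 then 1 else 0) (n : ℕ) :
    ∑ i ∈ Finset.range (n + 1), s (n - i) * r (i + 1) = - (s (n + 1) * b) := by
  have := h (n + 1)
  rw [Finset.sum_range_succ'] at this
  simp only [Nat.add_sub_add_right, Nat.sub_zero, hr, Nat.succ_ne_zero, if_false] at this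
  exact eq_neg_of_add_eq_zero_left this

lemma conv_shift' {R : Type*} [Ring R] (s r : ℕ → R) (b : R) (hr : r 0 = b)
    (h : ∀ n, ∑ i ∈ Finset.range (n + 1), r i * s (n - i) = if n = 0 then 1 else 0) (n : ℕ) :
    ∑ i ∈ Finset.range (n + 1), r (i + 1) * s (n - i) = - (b * s (n + 1)) := by
  have := h (n + 1)
  rw [Finset.sum_range_succ'] at this
  simp only [Nat.add_sub_add_right, Nat.sub_zero, hr, Nat.succ_ne_zero, if_false] at this
  exact eq_neg_of_add_eq_zero_left this

/-- Double convolution. -/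
def dconv {R : Type*} [Ring R] (s r : ℕ → R) (c j k : ℕ) : R :=
  ∑ a ∈ Finset.range (j + 1), ∑ b ∈ Finset.range (k + 1), s (j - a) * r (a + b + c) * s (k - b)

lemma dconv_right {R : Type*} [Ring R] (s r : ℕ → R) (b : R)
    (h : ∀ n, ∑ i ∈ Finset.range (n + 1), s (n - i) * r (i + 1) = - (s (n + 1) * b)) (j k : ℕ) :
    dconv s r 1 j (k + 1) = dconv s r 2 j k - s (j + 1) * b * s (k + 1) := by
  unfold dconv
  simp_rw [Finset.sum_range_succ' _ (k + 1)]
  rw [Finset.sum_add_distrib]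
  simp only [Nat.add_sub_add_right, Nat.sub_zero, add_zero]
  rw [← Finset.sum_mul, h, sub_eq_add_neg, neg_mul]
  congr 1

lemma dconv_left {R : Type*} [Ring R] (s r : ℕ → R) (b : R)
    (h : ∀ n, ∑ i ∈ Finset.range (n + 1), r (i + 1) * s (n - i) = - (b * s (n + 1))) (j k : ℕ) :
    dconv s r 1 (j + 1) k = dconv s r 2 j k - s (j + 1) * b * s (k + 1) := by
  unfold dconv
  rw [Finset.sum_range_succ' _ (j + 1)]
  simp only [Nat.add_sub_add_right, Nat.sub_zero, zero_add, mul_assoc]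
  rw [← Finset.mul_sum, h, sub_eq_add_neg, mul_neg]
  congr 1
  refine Finset.sum_congr rfl fun x _ => Finset.sum_congr rfl fun y _ => ?_
  rw [show x + 1 + y + 1 = x + y + 2 by ring]

lemma dconv_one {R : Type*} [Ring R] (s r : ℕ → R) (b : R) (hb : s 0 * b = 1)
    (h : ∀ n, ∑ i ∈ Finset.range (n + 1), s (n - i) * r (i + 1) = - (s (n + 1) * b))
    (h' : ∀ n, ∑ i ∈ Finset.range (n + 1), r (i + 1) * s (n - i) = - (b * s (n + 1))) (j k : ℕ) :
    dconv s r 1 j k = - s (j + k + 1) := by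
  induction j generalizing k with
  | zero =>
    unfold dconv
    simp only [zero_add, Finset.sum_range_one, Nat.sub_zero, mul_assoc]
    rw [← Finset.mul_sum, h', mul_neg, ← mul_assoc, hb, one_mul]
  | succ j ih =>
    rw [dconv_left s r b h', ← dconv_right s r b h, ih]
    congr 2; ring

lemma dconv_two {R : Type*} [Ring R] (s r : ℕ → R) (b : R) (hb : s 0 * b = 1)
    (h : ∀ n, ∑ i ∈ Finset.range (n + 1), s (n - i) * r (i + 1) = - (s (n + 1) * b))
    (h' : ∀ n, ∑ i ∈ Finset.range (n + 1), r (i + 1) * s (n - i) = - (b * s (n + 1))) (j k : ℕ) :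
    dconv s r 2 j k = - s (j + k + 2) + s (j + 1) * b * s (k + 1) := by
  have := dconv_right s r b h j k
  rw [dconv_one s r b hb h h'] at this
  rw [show j + (k + 1) + 1 = j + k + 2 by ring] at this
  rw [this]; abel

/-! ### Block matrices -/

/-- Block matrix with given blocks. -/
def blk (q n : ℕ) (f : ℕ → ℕ → Mq q) : Matrix (Fin (n + 1) × Fin q) (Fin (n + 1) × Fin q) ℂ :=
  Matrix.of fun p r => f p.1.1 r.1.1 p.2 r.2

/-- Block column with given blocks. -/
def bcol (q n : ℕ) (f : ℕ → Mq q) : Matrix (Fin (n + 1) × Fin q) (Fin q) ℂ :=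
  Matrix.of fun p b => f p.1.1 p.2 b

lemma blk_mul (q n : ℕ) (f g : ℕ → ℕ → Mq q) :
    blk q n f * blk q n g = blk q n (fun i k => ∑ j ∈ Finset.range (n + 1), f i j * g j k) := by
  ext p r
  simp only [blk, Matrix.mul_apply, Matrix.of_apply, Fintype.sum_prod_type, Matrix.sum_apply]
  rw [Finset.sum_range]

lemma blk_mul_bcol (q n : ℕ) (f : ℕ → ℕ → Mq q) (g : ℕ → Mq q) :
    blk q n f * bcol q n g = bcol q n (fun i => ∑ j ∈ Finset.range (n + 1), f i j * g j) := by
  ext p r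
  simp only [blk, bcol, Matrix.mul_apply, Matrix.of_apply, Fintype.sum_prod_type, Matrix.sum_apply]
  rw [Finset.sum_range]

lemma bcol_mul (q n : ℕ) (f : ℕ → Mq q) (A : Mq q) :
    bcol q n f * A = bcol q n (fun i => f i * A) := by
  ext p r
  simp only [bcol, Matrix.mul_apply, Matrix.of_apply]

lemma blk_conjTranspose (q n : ℕ) (f : ℕ → ℕ → Mq q) :
    (blk q n f)ᴴ = blk q n (fun i j => (f j i)ᴴ) := by
  ext p r
  simp [blk]

lemma blk_congr (q n : ℕ) {f g : ℕ → ℕ → Mq q} (h : ∀ i ≤ n, ∀ j ≤ n, f i j = g i j) :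
    blk q n f = blk q n g := by
  ext p r
  simp only [blk, Matrix.of_apply]
  rw [h _ (by omega) _ (by omega)]

lemma bcol_congr (q n : ℕ) {f g : ℕ → Mq q} (h : ∀ i ≤ n, f i = g i) :
    bcol q n f = bcol q n g := by
  ext p r
  simp only [bcol, Matrix.of_apply]
  rw [h _ (by omega)]

lemma sum_le_ite {R : Type*} [Ring R] (n i : ℕ) (hi : i ≤ n) (f g : ℕ → R) :
    ∑ j ∈ Finset.range (n + 1), (if j ≤ i then f j else 0) * g j =
      ∑ j ∈ Finset.range (i + 1), f j * g j := by
  simp only [ite_mul, zero_mul]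
  rw [← Finset.sum_filter]
  congr 1
  ext j
  simp only [Finset.mem_filter, Finset.mem_range]
  omega

lemma sum_le_ite' {R : Type*} [Ring R] (n i : ℕ) (hi : i ≤ n) (f g : ℕ → R) :
    ∑ j ∈ Finset.range (n + 1), g j * (if j ≤ i then f j else 0) =
      ∑ j ∈ Finset.range (i + 1), g j * f j := by
  simp only [mul_ite, mul_zero]
  rw [← Finset.sum_filter]
  congr 1
  ext j
  simp only [Finset.mem_filter, Finset.mem_range]
  omega

/-- The block triangular Toeplitz matrix `S_n · diag(s_0⁻¹)`. -/
def Wmat (q : ℕ) (s : ℕ → Mq q) (n : ℕ) : Matrix (Fin (n + 1) × Fin q) (Fin (n + 1) × Fin q) ℂ :=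
  blk q n (fun i j => if j ≤ i then s (i - j) * (s 0)⁻¹ else 0)

lemma spd_herm {q : ℕ} {s : ℕ → Mq q} (hs : IsStieltjesPD q s) (j : ℕ) : (s j)ᴴ = s j := by
  have h := (hs j).1.isHermitian
  ext a b
  have := congrFun (congrFun h (0, a)) (⟨j, by omega⟩, b)
  simp only [Hmat, Matrix.conjTranspose_apply, Matrix.of_apply] at this
  simpa using this

lemma spd_unit {q : ℕ} {s : ℕ → Mq q} (hs : IsStieltjesPD q s) : (s 0).PosDef := by
  have h := (hs 0).1.submatrix (e := fun a : Fin q => ((0 : Fin 1), a))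
    (fun a b hab => by simpa using hab)
  have e : s 0 = (Hmat q s 0).submatrix (fun a => ((0 : Fin 1), a)) (fun a => ((0 : Fin 1), a)) := by
    ext a b; simp [Hmat]
  rw [e]; exact h

lemma recip_conv {q : ℕ} {s : ℕ → Mq q} (h0 : s 0 * (s 0)⁻¹ = 1) (n : ℕ) :
    ∑ i ∈ Finset.range (n + 1), s (n - i) * reciprocal q s i = if n = 0 then 1 else 0 := by
  cases n with
  | zero => simp [reciprocal, h0]
  | succ n =>
    rw [Finset.sum_range_succ, reciprocal]
    rw [Finset.sum_attach (Finset.range (n + 1)) (fun l => s (n + 1 - l) * reciprocal q s l)]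
    simp only [Nat.sub_self, ← mul_assoc, mul_neg, h0]
    simp

section step

variable {q : ℕ} {s : ℕ → Mq q}

lemma facts (hs : IsStieltjesPD q s) :
    s 0 * (s 0)⁻¹ = 1 ∧ (s 0)⁻¹ * s 0 = 1 ∧
    (∀ n, ∑ i ∈ Finset.range (n + 1), s (n - i) * reciprocal q s (i + 1) =
      - (s (n + 1) * (s 0)⁻¹)) ∧
    (∀ n, ∑ i ∈ Finset.range (n + 1), reciprocal q s (i + 1) * s (n - i) =
      - ((s 0)⁻¹ * s (n + 1))) := by
  have hu := (Matrix.isUnit_iff_isUnit_det _).mp (spd_unit hs).isUnit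
  have h1 := Matrix.mul_nonsing_inv _ hu
  have h2 := Matrix.nonsing_inv_mul _ hu
  have hc := recip_conv h1
  exact ⟨h1, h2, conv_shift s _ _ (by rw [reciprocal]) hc,
    conv_shift' s _ _ (by rw [reciprocal]) (left_conv s _ _ h2 hc)⟩

lemma W_conj (hs : IsStieltjesPD q s) (n : ℕ) (c : ℕ) :
    Wmat q s n * blk q n (fun i j => katetov1 q s (i + j + c)) * (Wmat q s n)ᴴ =
      blk q n (fun i j => - dconv s (reciprocal q s) (c + 1) i j) := by
  obtain ⟨h1, h2, -, -⟩ := facts hs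
  have hA : ((s 0)⁻¹)ᴴ = (s 0)⁻¹ := by
    rw [Matrix.conjTranspose_nonsing_inv, spd_herm hs]
  have hW : ∀ i j, (if j ≤ i then s (i - j) * (s 0)⁻¹ else 0)ᴴ =
      if j ≤ i then (s 0)⁻¹ * s (i - j) else 0 := by
    intro i j
    split_ifs
    · rw [Matrix.conjTranspose_mul, hA, spd_herm hs]
    · simp
  rw [Wmat, blk_conjTranspose, mul_assoc, blk_mul, blk_mul]
  apply blk_congr
  intro i hi k hk
  simp only [hW]
  rw [sum_le_ite n i hi]
  unfold dconv
  rw [← Finset.sum_neg_distrib]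
  refine Finset.sum_congr rfl fun a _ => ?_
  rw [sum_le_ite' n k hk, Finset.mul_sum, ← Finset.sum_neg_distrib]
  refine Finset.sum_congr rfl fun b _ => ?_
  rw [katetov1, ← add_assoc]
  generalize reciprocal q s (a + b + c + 1) = x
  calc s (i - a) * (s 0)⁻¹ * (-s 0 * x * s 0 * ((s 0)⁻¹ * s (k - b)))
      = - (s (i - a) * ((s 0)⁻¹ * s 0) * x * (s 0 * (s 0)⁻¹) * s (k - b)) := by noncomm_ring
    _ = _ := by rw [h1, h2]; simp

lemma K_eq (hs : IsStieltjesPD q s) (n : ℕ) :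
    Kmat q s n = Wmat q s n * Hmat q (katetov1 q s) n * (Wmat q s n)ᴴ := by
  obtain ⟨h1, h2, h3, h4⟩ := facts hs
  have := W_conj hs n 0
  simp only [zero_add, dconv_one s _ _ h1 h3 h4, neg_neg] at this
  exact this.symm

lemma Schur_eq (hs : IsStieltjesPD q s) (n : ℕ) :
    blk q n (fun i j => s (i + j + 2) - s (i + 1) * (s 0)⁻¹ * s (j + 1)) =
      Wmat q s n * Kmat q (katetov1 q s) n * (Wmat q s n)ᴴ := by
  obtain ⟨h1, h2, h3, h4⟩ := facts hs
  have := W_conj hs n 1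
  simp only [Nat.reduceAdd, dconv_two s _ _ h1 h3 h4] at this
  refine Eq.trans ?_ this.symm
  apply blk_congr
  intros
  abel

lemma y_eq (hs : IsStieltjesPD q s) (n : ℕ) :
    ycol q s n = Wmat q s n * (vcol q n * s 0) := by
  obtain ⟨h1, h2, h3, h4⟩ := facts hs
  have hv : vcol q n = bcol q n (fun i => if i ≤ 0 then 1 else 0) := by
    ext p b
    simp only [vcol, bcol, Matrix.of_apply, Nat.le_zero]
    by_cases h : p.1.1 = 0 <;> simp [h, Matrix.one_apply]
  rw [hv, bcol_mul, Wmat, blk_mul_bcol]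
  change bcol q n s = _
  apply bcol_congr
  intro i hi
  rw [sum_le_ite n i hi, Finset.sum_eq_single 0]
  · simp [mul_assoc, h2]
  · intro j _ hj; simp [hj]
  · simp

lemma y1_eq (hs : IsStieltjesPD q s) (n : ℕ) :
    bcol q n (fun i => s (i + 1)) = Wmat q s n * ycol q (katetov1 q s) n := by
  obtain ⟨h1, h2, h3, h4⟩ := facts hs
  change _ = Wmat q s n * bcol q n (katetov1 q s)
  rw [Wmat, blk_mul_bcol]
  apply bcol_congr
  intro i hi
  rw [sum_le_ite n i hi]
  have : ∀ j, s (i - j) * (s 0)⁻¹ * katetov1 q s j =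
      - (s (i - j) * reciprocal q s (j + 1) * s 0) := by
    intro j
    rw [katetov1]
    calc _ = - (s (i - j) * ((s 0)⁻¹ * s 0) * reciprocal q s (j + 1) * s 0) := by noncomm_ring
      _ = _ := by rw [h2]; simp
  simp only [this, Finset.sum_neg_distrib]
  rw [← Finset.sum_mul, h3, neg_mul, neg_neg, mul_assoc, h2, mul_one]

lemma W_unit (hs : IsStieltjesPD q s) (n : ℕ) : IsUnit (Wmat q s n) := by
  have h := (hs n).2.isUnit
  rw [K_eq hs, mul_assoc, Matrix.isUnit_iff_isUnit_det, Matrix.det_mul] at h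
  exact (Matrix.isUnit_iff_isUnit_det _).mpr (isUnit_of_mul_isUnit_left h)

lemma W_conj_inv {m k : Type*} [Fintype m] [DecidableEq m] [Fintype k]
    (W X : Matrix m m ℂ) (c : Matrix m k ℂ) (hW : IsUnit W) :
    (W * c)ᴴ * (W * X * Wᴴ)⁻¹ * (W * c) = cᴴ * X⁻¹ * c := by
  have hd := (Matrix.isUnit_iff_isUnit_det _).mp hW
  have hd' : IsUnit (Wᴴ).det := (Matrix.isUnit_iff_isUnit_det _).mp hW.star
  rw [Matrix.mul_inv_rev, Matrix.mul_inv_rev, Matrix.conjTranspose_mul]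
  calc cᴴ * Wᴴ * (Wᴴ⁻¹ * (X⁻¹ * W⁻¹)) * (W * c)
      = cᴴ * (Wᴴ * Wᴴ⁻¹) * X⁻¹ * (W⁻¹ * W) * c := by simp only [Matrix.mul_assoc]
    _ = _ := by
      rw [Matrix.mul_nonsing_inv _ hd', Matrix.nonsing_inv_mul _ hd, Matrix.mul_one,
        Matrix.mul_one]

lemma L_sum (hs : IsStieltjesPD q s) (n : ℕ) :
    (ycol q s n)ᴴ * (Kmat q s n)⁻¹ * ycol q s n =
      s 0 * ((vcol q n)ᴴ * (Hmat q (katetov1 q s) n)⁻¹ * vcol q n) * s 0 := by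
  rw [y_eq hs, K_eq hs, W_conj_inv _ _ _ (W_unit hs n), Matrix.conjTranspose_mul, spd_herm hs]
  simp only [Matrix.mul_assoc]

lemma H1_pd (hs : IsStieltjesPD q s) (n : ℕ) : (Hmat q (katetov1 q s) n).PosDef := by
  have h := (hs n).2
  rw [K_eq hs] at h
  exact (Matrix.IsUnit.posDef_star_right_conjugate_iff (W_unit hs n)).mp h

/-- Splitting off the first block. -/
def splitEquiv (q n : ℕ) : Fin q ⊕ (Fin (n + 1) × Fin q) ≃ Fin (n + 2) × Fin q :=
  Equiv.ofBijective (Sum.elim (fun a => ((0 : Fin (n + 2)), a)) (fun p => (p.1.succ, p.2))) <| by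
    constructor
    · rintro (a | ⟨i, a⟩) (b | ⟨j, b⟩) h
      · simpa using h
      · simp at h; exact absurd h.1.symm (Fin.succ_ne_zero _)
      · simp at h
      · simpa using h
    · rintro ⟨i, a⟩
      refine Fin.cases ⟨Sum.inl a, rfl⟩ (fun j => ⟨Sum.inr (j, a), rfl⟩) i

lemma splitEquiv_inl (q n : ℕ) (a : Fin q) : splitEquiv q n (Sum.inl a) = (0, a) := rfl

lemma splitEquiv_inr (q n : ℕ) (p : Fin (n + 1) × Fin q) :
    splitEquiv q n (Sum.inr p) = (p.1.succ, p.2) := rfl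

lemma H_split (hs : IsStieltjesPD q s) (n : ℕ) :
    (Hmat q s (n + 1)).submatrix (splitEquiv q n) (splitEquiv q n) =
      Matrix.fromBlocks (s 0) (bcol q n (fun i => s (i + 1)))ᴴ
        (bcol q n (fun i => s (i + 1))) (blk q n (fun i j => s (i + j + 2))) := by
  ext (a | ⟨i, a⟩) (b | ⟨j, b⟩)
  · simp [splitEquiv_inl, splitEquiv_inr, Hmat]
  · have := congrFun (congrFun (spd_herm hs (j.1 + 1)) a) b
    simp only [Matrix.conjTranspose_apply] at this
    simp [splitEquiv_inl, splitEquiv_inr, Hmat, bcol, this]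
  · simp [splitEquiv_inl, splitEquiv_inr, Hmat, bcol]
  · simp [splitEquiv_inl, splitEquiv_inr, Hmat, blk, show i.1 + 1 + (j.1 + 1) = i.1 + j.1 + 2 by ring]

lemma v_split (n : ℕ) :
    (vcol q (n + 1)).submatrix (splitEquiv q n) id = Matrix.fromRows 1 0 := by
  ext (a | ⟨i, a⟩) b
  · simp [splitEquiv_inl, splitEquiv_inr, vcol, Matrix.one_apply]
  · simp [splitEquiv_inl, splitEquiv_inr, vcol]

lemma Schur_blk (hs : IsStieltjesPD q s) (n : ℕ) :
    blk q n (fun i j => s (i + j + 2)) - bcol q n (fun i => s (i + 1)) * (s 0)⁻¹ *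
      (bcol q n (fun i => s (i + 1)))ᴴ =
    blk q n (fun i j => s (i + j + 2) - s (i + 1) * (s 0)⁻¹ * s (j + 1)) := by
  rw [bcol_mul]
  ext p r
  simp only [Matrix.sub_apply, blk, bcol, Matrix.of_apply, Matrix.mul_apply,
    Matrix.conjTranspose_apply]
  congr 1
  refine Finset.sum_congr rfl fun x _ => ?_
  congr 1
  have := congrFun (congrFun (spd_herm hs (r.1.1 + 1)) x) r.2
  simpa only [Matrix.conjTranspose_apply] using this

lemma K1_pd (hs : IsStieltjesPD q s) (n : ℕ) : (Kmat q (katetov1 q s) n).PosDef := by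
  have h := (hs (n + 1)).1.submatrix (splitEquiv q n).injective
  rw [H_split hs] at h
  obtain ⟨inv⟩ := (spd_unit hs).isUnit.nonempty_invertible
  have hp := h.posSemidef
  have hu := h.isUnit
  rw [Matrix.isUnit_fromBlocks_iff_of_invertible₁₁, Matrix.invOf_eq_nonsing_inv,
    Schur_blk hs, Schur_eq hs] at hu
  have hp' := (Matrix.PosDef.fromBlocks₁₁ ((bcol q n (fun i => s (i + 1)))ᴴ)
    (blk q n (fun i j => s (i + j + 2))) (spd_unit hs)).mp (by
      rwa [Matrix.conjTranspose_conjTranspose])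
  rw [Matrix.conjTranspose_conjTranspose, Schur_blk hs, Schur_eq hs] at hp'
  exact (Matrix.IsUnit.posDef_star_right_conjugate_iff (W_unit hs n)).mp
    (hp'.posDef_iff_isUnit.mpr hu)

lemma M_sum (hs : IsStieltjesPD q s) (n : ℕ) :
    (vcol q (n + 1))ᴴ * (Hmat q s (n + 1))⁻¹ * vcol q (n + 1) =
      (s 0)⁻¹ + (s 0)⁻¹ * ((ycol q (katetov1 q s) n)ᴴ * (Kmat q (katetov1 q s) n)⁻¹ *
        ycol q (katetov1 q s) n) * (s 0)⁻¹ := by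
  have e1 : (vcol q (n + 1))ᴴ * (Hmat q s (n + 1))⁻¹ * vcol q (n + 1) =
      ((vcol q (n + 1)).submatrix (splitEquiv q n) id)ᴴ *
      ((Hmat q s (n + 1)).submatrix (splitEquiv q n) (splitEquiv q n))⁻¹ *
      (vcol q (n + 1)).submatrix (splitEquiv q n) id := by
    rw [Matrix.inv_submatrix_equiv, Matrix.conjTranspose_submatrix, Matrix.submatrix_mul_equiv,
      Matrix.submatrix_mul_equiv]
    rfl
  have h := (hs (n + 1)).1.submatrix (splitEquiv q n).injective
  rw [H_split hs] at h
  rw [e1, v_split, H_split hs]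
  obtain ⟨i1⟩ := (spd_unit hs).isUnit.nonempty_invertible
  obtain ⟨i2⟩ := h.isUnit.nonempty_invertible
  have hS : IsUnit (blk q n (fun i j => s (i + j + 2)) - bcol q n (fun i => s (i + 1)) * ⅟(s 0) *
      (bcol q n (fun i => s (i + 1)))ᴴ) :=
    Matrix.isUnit_fromBlocks_iff_of_invertible₁₁.mp h.isUnit
  obtain ⟨i3⟩ := hS.nonempty_invertible
  rw [← Matrix.invOf_eq_nonsing_inv, Matrix.invOf_fromBlocks₁₁_eq]
  simp only [Matrix.invOf_eq_nonsing_inv]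
  rw [Schur_blk hs, Schur_eq hs, ← W_conj_inv _ _ _ (W_unit hs n), ← y1_eq hs]
  rw [Matrix.mul_assoc, Matrix.fromBlocks_mul_fromRows, Matrix.conjTranspose_fromRows_eq_fromCols_conjTranspose,
    Matrix.fromCols_mul_fromRows]
  simp [Matrix.mul_assoc]

lemma kat_spd (hs : IsStieltjesPD q s) : IsStieltjesPD q (katetov1 q s) :=
  fun n => ⟨H1_pd hs n, K1_pd hs n⟩

/-- The zeroth block inverse. -/
lemma v0_sum (s : ℕ → Mq q) :
    (vcol q 0)ᴴ * (Hmat q s 0)⁻¹ * vcol q 0 = (s 0)⁻¹ := by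
  have e : (Hmat q s 0) = (s 0).submatrix (Equiv.uniqueProd (Fin q) (Fin 1))
      (Equiv.uniqueProd (Fin q) (Fin 1)) := by
    ext ⟨i, a⟩ ⟨j, b⟩
    simp [Hmat]
  have e2 : vcol q 0 = (1 : Mq q).submatrix (Equiv.uniqueProd (Fin q) (Fin 1)) id := by
    ext ⟨i, a⟩ b
    simp [vcol, Matrix.one_apply]
  rw [e, e2, Matrix.inv_submatrix_equiv, Matrix.conjTranspose_submatrix,
    Matrix.submatrix_mul_equiv, Matrix.submatrix_mul_equiv]
  simp

lemma y0_sum (hs : IsStieltjesPD q s) :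
    (ycol q s 0)ᴴ * (Kmat q s 0)⁻¹ * ycol q s 0 = s 0 * (s 1)⁻¹ * s 0 := by
  have e : (Kmat q s 0) = (s 1).submatrix (Equiv.uniqueProd (Fin q) (Fin 1))
      (Equiv.uniqueProd (Fin q) (Fin 1)) := by
    ext ⟨i, a⟩ ⟨j, b⟩
    simp [Kmat]
  have e2 : ycol q s 0 = (s 0).submatrix (Equiv.uniqueProd (Fin q) (Fin 1)) id := by
    ext ⟨i, a⟩ b
    simp [ycol]
  rw [e, e2, Matrix.inv_submatrix_equiv, Matrix.conjTranspose_submatrix,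
    Matrix.submatrix_mul_equiv, Matrix.submatrix_mul_equiv, spd_herm hs]
  simp

lemma DSL_eq (hs : IsStieltjesPD q s) (k : ℕ) :
    DSL q s k = s 0 * DSM q (katetov1 q s) k * s 0 := by
  cases k with
  | zero => rw [DSL, DSM, ← y0_sum hs, L_sum hs, v0_sum]
  | succ k => rw [DSL, DSM, L_sum hs, L_sum hs, mul_sub, sub_mul]

lemma DSM_eq (hs : IsStieltjesPD q s) (k : ℕ) :
    DSM q s (k + 1) = (s 0)⁻¹ * DSL q (katetov1 q s) k * (s 0)⁻¹ := by
  cases k with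
  | zero => rw [DSM, DSL, ← y0_sum (kat_spd hs), M_sum hs, v0_sum, add_sub_cancel_left]
  | succ k => rw [DSM, DSL, M_sum hs, M_sum hs, mul_sub, sub_mul, add_sub_add_left_eq_sub]

end step

lemma katetov_spd {q : ℕ} {s : ℕ → Mq q} (hs : IsStieltjesPD q s) (ℓ : ℕ) :
    IsStieltjesPD q (katetov q ℓ s) := by
  induction ℓ with
  | zero => exact hs
  | succ ℓ ih =>
    rw [katetov, Function.iterate_succ_apply']
    exact kat_spd ih

/-- Intertwining relations between `𝕃^{(ℓ)}`, `𝕄^{(ℓ)}` and `𝐐_0^{(ℓ)}`. -/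
theorem stmt9 (q : ℕ) (hq : 1 ≤ q) (s : ℕ → Mq q) (hs : IsStieltjesPD q s) (k ℓ : ℕ) (z : ℂ) :
    LL q (katetov q ℓ s) k * QQ0 q s ℓ z = QQ0 q s ℓ z * MM q (katetov q (ℓ + 1) s) k z ∧
      MM q (katetov q ℓ s) (k + 1) z * QQ0 q s ℓ z =
        QQ0 q s ℓ z * LL q (katetov q (ℓ + 1) s) k := by
  have hsucc : katetov q (ℓ + 1) s = katetov1 q (katetov q ℓ s) := by
    rw [katetov, Function.iterate_succ_apply']; rfl
  have ht := katetov_spd hs ℓ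
  rw [hsucc]
  unfold LL MM QQ0
  rw [DSL_eq ht, DSM_eq ht]
  obtain ⟨h1, h2, -, -⟩ := facts ht
  generalize katetov q ℓ s = t at *
  simp only [Matrix.fromBlocks_multiply]
  constructor
  · simp [Matrix.mul_assoc, h1]
  · simp [Matrix.mul_assoc, h2]

end
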